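/- arXiv:2602.21851 — 3 statements merged into one kernel-verified Lean document; each statement's English description precedes it below -/
import Mathlib

section
/- Let d ≥ 2 and 1 ≤ p < d²/2. There exist constants θ = θ(p,d) > 0 and C = C(p,d) < ∞ such that for all n ≥ 1 and all λ > 0, if X_1,…,X_n are i.i.d. random variables uniformly distributed on [0,1]^d, then ℙ( |C^p_TS(X) − 𝔼[C^p_TS(X)]| ≥ λ n^{1−p/d} ) ≤ C n^{−θ} λ^{−2}. -/
open MeasureTheory Metric
open scoped Classical

/-- The unit cube `[0,1]^d` in `ℝ^d` (with the Euclidean norm). -/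
def unitCube (d : ℕ) : Set (EuclideanSpace ℝ (Fin d)) :=
  {x | ∀ k, x k ∈ Set.Icc (0 : ℝ) 1}

/-- The `p`-cost of the Hamiltonian tour determined by the permutation `τ`:
`L_p(τ;x) = ∑_{k=1}^n |x_{τ(k)} − x_{τ(k+1)}|^p`, with the cyclic convention
`τ(n+1) := τ(1)` (the cyclic successor `k ↦ k+1` is `finRotate n`). -/
noncomputable def tspLen {d n : ℕ} (p : ℝ)
    (x : Fin n → EuclideanSpace ℝ (Fin d)) (τ : Equiv.Perm (Fin n)) : ℝ :=
  ∑ k, ‖x (τ k) - x (τ (finRotate n k))‖ ^ p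

/-- The uniform probability measure on the unit cube `[0,1]^d`
(Lebesgue measure restricted to the cube, which has total mass one). -/
noncomputable def cubeUniform (d : ℕ) : Measure (EuclideanSpace ℝ (Fin d)) :=
  volume.restrict (unitCube d)

/-- The optimal TSP `p`-cost `C^p_TS(x) = min_τ L_p(τ;x)`. -/
noncomputable def tspCost {d n : ℕ} (p : ℝ)
    (x : Fin n → EuclideanSpace ℝ (Fin d)) : ℝ :=
  ⨅ τ : Equiv.Perm (Fin n), tspLen p x τ


/-- A cyclic enumeration of `Fin (m + 1)`, extended periodically to all of `ℕ`. -/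
def IsTour {m : ℕ} (u : ℕ → Fin (m + 1)) : Prop :=
  Function.Periodic u (m + 1) ∧ Set.InjOn u (Set.Iio (m + 1))

theorem IsTour.eq_mod {m : ℕ} {u : ℕ → Fin (m + 1)} (hu : IsTour u) (a : ℕ) :
    u (a % (m + 1)) = u a := hu.1.map_mod_nat a

theorem IsTour.modEq {m : ℕ} {u : ℕ → Fin (m + 1)} (hu : IsTour u) {a b : ℕ} (h : u a = u b) :
    a % (m + 1) = b % (m + 1) := by
  refine hu.2 (Nat.mod_lt _ m.succ_pos) (Nat.mod_lt _ m.succ_pos) ?_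
  rw [hu.eq_mod, hu.eq_mod, h]

theorem IsTour.eq_of_modEq {m : ℕ} {u : ℕ → Fin (m + 1)} (hu : IsTour u) {a b : ℕ}
    (h : a % (m + 1) = b % (m + 1)) : u a = u b := by
  rw [← hu.eq_mod a, h, hu.eq_mod]

theorem IsTour.succ_eq {m : ℕ} {u : ℕ → Fin (m + 1)} (hu : IsTour u) {a b : ℕ} (h : u a = u b) :
    u (a + 1) = u (b + 1) :=
  hu.eq_of_modEq (Nat.ModEq.add_right 1 (hu.modEq h))

theorem IsTour.exists_le {m : ℕ} {u : ℕ → Fin (m + 1)} (hu : IsTour u) (j : Fin (m + 1)) :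
    ∃ k ≤ m, u k = j := by
  have hinj : Function.Injective (fun k : Fin (m + 1) => u k) := fun a b h =>
    Fin.ext (hu.2 a.2 b.2 h)
  obtain ⟨k, hk⟩ := (Finite.injective_iff_surjective.1 hinj) j
  exact ⟨k, Nat.lt_succ_iff.1 k.2, hk⟩

theorem IsTour.shift {m : ℕ} {u : ℕ → Fin (m + 1)} (hu : IsTour u) (c : ℕ) :
    IsTour (fun k => u (k + c)) := by
  refine ⟨fun k => ?_, fun a ha b hb h => ?_⟩
  · show u (k + (m + 1) + c) = u (k + c)
    rw [show k + (m + 1) + c = k + c + (m + 1) by ring, hu.1]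
  · have := Nat.ModEq.add_right_cancel' c (hu.modEq h)
    rwa [Nat.ModEq, Nat.mod_eq_of_lt ha, Nat.mod_eq_of_lt hb] at this

theorem sum_range_shift_of_periodic {f : ℕ → ℝ} {N : ℕ} (hf : Function.Periodic f N) (c : ℕ) :
    ∑ k ∈ Finset.range N, f (k + c) = ∑ k ∈ Finset.range N, f k := by
  induction c with
  | zero => simp
  | succ c ih =>
    rw [← ih]
    have h1 := Finset.sum_range_succ (fun k => f (k + c)) N
    have h2 := Finset.sum_range_succ' (fun k => f (k + c)) N
    have h3 : f (N + c) = f (0 + c) := by rw [zero_add, add_comm, hf]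
    simp only [h3] at h1
    rw [h1] at h2
    simpa [add_assoc, add_comm 1 c] using h2.symm

section Tours

variable {d : ℕ}

/-- The `p`-cost of a periodically extended tour. -/
noncomputable def tourLen {m : ℕ} (p : ℝ) (x : Fin (m + 1) → EuclideanSpace ℝ (Fin d))
    (u : ℕ → Fin (m + 1)) : ℝ :=
  ∑ k ∈ Finset.range (m + 1), ‖x (u k) - x (u (k + 1))‖ ^ p

theorem tourLen_shift {m : ℕ} (p : ℝ) (x : Fin (m + 1) → EuclideanSpace ℝ (Fin d))
    {u : ℕ → Fin (m + 1)} (hu : IsTour u) (c : ℕ) :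
    tourLen p x (fun k => u (k + c)) = tourLen p x u := by
  have h : Function.Periodic (fun k => ‖x (u k) - x (u (k + 1))‖ ^ p) (m + 1) := fun k => by
    simp only [hu.1 k, show k + (m + 1) + 1 = k + 1 + (m + 1) by ring, hu.1 (k + 1)]
  have := sum_range_shift_of_periodic h c
  simpa [tourLen, add_right_comm] using this

theorem IsTour.tourLen_eq {m : ℕ} (p : ℝ) (x : Fin (m + 1) → EuclideanSpace ℝ (Fin d))
    {u : ℕ → Fin (m + 1)} (hu : IsTour u) :
    tourLen p x u =
      ∑ k ∈ Finset.range m, ‖x (u k) - x (u (k + 1))‖ ^ p + ‖x (u m) - x (u 0)‖ ^ p := by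
  rw [tourLen, Finset.sum_range_succ]
  have : u (m + 1) = u 0 := by simpa using hu.1 0
  rw [this]

theorem tspLen_eq_path {m : ℕ} (p : ℝ) (x : Fin (m + 1) → EuclideanSpace ℝ (Fin d))
    (τ : Equiv.Perm (Fin (m + 1))) (u : ℕ → Fin (m + 1)) (hu : ∀ k : Fin (m + 1), u k = τ k) :
    tspLen p x τ =
      ∑ k ∈ Finset.range m, ‖x (u k) - x (u (k + 1))‖ ^ p + ‖x (u m) - x (u 0)‖ ^ p := by
  rw [tspLen, Fin.sum_univ_castSucc, Finset.sum_range]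
  congr 1
  · refine Finset.sum_congr rfl fun k _ => ?_
    have h1 := hu k.castSucc
    have h2 := hu k.succ
    simp only [Fin.val_castSucc, Fin.val_succ] at h1 h2
    rw [h1, h2, finRotate_apply, Fin.coeSucc_eq_succ]
  · have h1 := hu (Fin.last m)
    have h2 := hu 0
    simp only [Fin.val_last, Fin.val_zero] at h1 h2
    rw [h1, h2, finRotate_apply, Fin.last_add_one]

theorem tspCost_le_tspLen {n : ℕ} (p : ℝ) (x : Fin n → EuclideanSpace ℝ (Fin d))
    (τ : Equiv.Perm (Fin n)) : tspCost p x ≤ tspLen p x τ :=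
  ciInf_le (Set.finite_range _).bddBelow τ

theorem tspCost_le_path {m : ℕ} (p : ℝ) (x : Fin (m + 1) → EuclideanSpace ℝ (Fin d))
    (u : ℕ → Fin (m + 1)) (hu : ∀ a ≤ m, ∀ b ≤ m, u a = u b → a = b) :
    tspCost p x ≤
      ∑ k ∈ Finset.range m, ‖x (u k) - x (u (k + 1))‖ ^ p + ‖x (u m) - x (u 0)‖ ^ p := by
  have hinj : Function.Injective (fun k : Fin (m + 1) => u k) := fun a b h =>
    Fin.ext (hu a (Nat.lt_succ_iff.1 a.2) b (Nat.lt_succ_iff.1 b.2) h)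
  let τ : Equiv.Perm (Fin (m + 1)) :=
    Equiv.ofBijective _ (Finite.injective_iff_bijective.1 hinj)
  rw [← tspLen_eq_path p x τ u fun _ => rfl]
  exact tspCost_le_tspLen p x τ

theorem exists_tour_eq_tspCost {m : ℕ} (p : ℝ) (x : Fin (m + 1) → EuclideanSpace ℝ (Fin d)) :
    ∃ u : ℕ → Fin (m + 1), IsTour u ∧ tourLen p x u = tspCost p x := by
  obtain ⟨τ, hτ⟩ := exists_eq_ciInf_of_finite (f := fun τ => tspLen p x τ)
  have hu : IsTour (fun k => τ (Fin.ofNat (m + 1) k)) := by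
    refine ⟨fun k => ?_, fun a ha b hb h => ?_⟩
    · simp [Fin.ofNat]
    · have := congrArg Fin.val (τ.injective h)
      simpa [Fin.ofNat, Nat.mod_eq_of_lt ha, Nat.mod_eq_of_lt hb] using this
  refine ⟨_, hu, ?_⟩
  rw [hu.tourLen_eq, ← tspLen_eq_path p x τ]
  · exact hτ
  · intro k; simp

/-- Reversing a segment of an optimal tour does not decrease its cost. -/
theorem two_opt {m : ℕ} {p : ℝ} {x : Fin (m + 1) → EuclideanSpace ℝ (Fin d)}
    {u : ℕ → Fin (m + 1)} (hu : IsTour u) (hopt : tourLen p x u = tspCost p x) {a b : ℕ}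
    (hab : u a ≠ u b) :
    ‖x (u a) - x (u (a + 1))‖ ^ p + ‖x (u b) - x (u (b + 1))‖ ^ p ≤
      ‖x (u a) - x (u b)‖ ^ p + ‖x (u (a + 1)) - x (u (b + 1))‖ ^ p := by
  obtain ⟨v, hv, hvopt, hvm, hv0, q, hq, hvq, hvq1⟩ : ∃ v : ℕ → Fin (m + 1), IsTour v ∧
      tourLen p x v = tspCost p x ∧ v m = u a ∧ v 0 = u (a + 1) ∧
      ∃ q ≤ m, v q = u b ∧ v (q + 1) = u (b + 1) := by
    refine ⟨fun k => u (k + (a + 1)), hu.shift _, (tourLen_shift p x hu _).trans hopt, ?_, ?_, ?_⟩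
    · show u (m + (a + 1)) = u a
      rw [show m + (a + 1) = a + (m + 1) by ring, hu.1]
    · simp
    · obtain ⟨q, hq, h⟩ := (hu.shift (a + 1)).exists_le (u b)
      refine ⟨q, hq, h, ?_⟩
      have := hu.succ_eq h
      rwa [add_right_comm] at this
  rw [← hvm, ← hvq] at hab
  rw [← hvm, ← hv0, ← hvq, ← hvq1]
  have hqm : q < m := lt_of_le_of_ne hq fun h => hab (by rw [h])
  have hle := tspCost_le_path p x (fun k => if k ≤ q then v (q - k) else v k) (by
    intro s hs t ht h
    split_ifs at h
    · have := hv.2 (show q - s < _ by omega) (show q - t < _ by omega) h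
      omega
    · have := hv.2 (show q - s < _ by omega) (show t < _ by omega) h
      omega
    · have := hv.2 (show s < _ by omega) (show q - t < _ by omega) h
      omega
    · exact hv.2 (show s < _ by omega) (show t < _ by omega) h)
  rw [← hvopt, hv.tourLen_eq] at hle
  obtain ⟨r, hr⟩ : ∃ r, m = q + 1 + r := Nat.exists_eq_add_of_le hqm
  have hsplit (f : ℕ → ℝ) : ∑ k ∈ Finset.range m, f k =
      ∑ k ∈ Finset.range q, f k + f q + ∑ k ∈ Finset.range r, f (q + 1 + k) := by
    rw [hr, Finset.sum_range_add, Finset.sum_range_succ]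
  rw [hsplit, hsplit] at hle
  have e1 : ∑ k ∈ Finset.range q, ‖x (if k ≤ q then v (q - k) else v k) -
      x (if k + 1 ≤ q then v (q - (k + 1)) else v (k + 1))‖ ^ p =
      ∑ k ∈ Finset.range q, ‖x (v k) - x (v (k + 1))‖ ^ p := by
    rw [← Finset.sum_range_reflect]
    refine Finset.sum_congr rfl fun k hk => ?_
    have hk' := Finset.mem_range.1 hk
    rw [if_pos (by omega), if_pos (by omega), norm_sub_rev,
      show q - (q - 1 - k) = k + 1 by omega, show q - (q - 1 - k + 1) = k by omega]
  have e2 : ∑ k ∈ Finset.range r,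
      ‖x (if q + 1 + k ≤ q then v (q - (q + 1 + k)) else v (q + 1 + k)) -
      x (if q + 1 + k + 1 ≤ q then v (q - (q + 1 + k + 1)) else v (q + 1 + k + 1))‖ ^ p =
      ∑ k ∈ Finset.range r, ‖x (v (q + 1 + k)) - x (v (q + 1 + k + 1))‖ ^ p := by
    refine Finset.sum_congr rfl fun k _ => ?_
    rw [if_neg (by omega), if_neg (by omega)]
  rw [e1, e2, if_pos le_rfl, if_neg (by omega), if_neg (by omega), if_pos (Nat.zero_le _),
    Nat.sub_self, Nat.sub_zero] at hle
  linarith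

theorem tspCost_le_of_move {m : ℕ} {p : ℝ} {x x' : Fin (m + 1) → EuclideanSpace ℝ (Fin d)}
    {u : ℕ → Fin (m + 1)} (hu : IsTour u) (hopt : tourLen p x u = tspCost p x)
    {i j : Fin (m + 1)} (hij : j ≠ i) (hx : ∀ k ≠ i, x' k = x k) {δ L B : ℝ}
    (hj : ‖x j - x' i‖ ≤ δ) (hL : ∀ k, ‖x (u k) - x (u (k + 1))‖ ≤ L)
    (hremove : ∀ a b y : EuclideanSpace ℝ (Fin d), ‖a - y‖ ≤ L → ‖y - b‖ ≤ L →
      ‖a - b‖ ^ p ≤ ‖a - y‖ ^ p + ‖y - b‖ ^ p + B)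
    (hinsert : ∀ a b y : EuclideanSpace ℝ (Fin d), ‖a - y‖ ≤ δ → ‖a - b‖ ≤ 2 * L →
      ‖a - y‖ ^ p + ‖y - b‖ ^ p ≤ ‖a - b‖ ^ p + B) :
    tspCost p x' ≤ tspCost p x + 2 * B := by
  obtain ⟨v, hv, hvopt, hv0, hvL⟩ : ∃ v : ℕ → Fin (m + 1), IsTour v ∧
      tourLen p x v = tspCost p x ∧ v 0 = i ∧ ∀ k, ‖x (v k) - x (v (k + 1))‖ ≤ L := by
    obtain ⟨c, -, hc⟩ := hu.exists_le i
    refine ⟨fun k => u (k + c), hu.shift _, (tourLen_shift p x hu _).trans hopt, by simpa,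
      fun k => ?_⟩
    have := hL (k + c)
    rwa [add_right_comm] at this
  have hL0 : 0 ≤ L := (norm_nonneg _).trans (hvL 0)
  have hvi : ∀ k, 0 < k → k ≤ m → x' (v k) = x (v k) := fun k hk hkm => hx _ fun h => by
    have := hv.2 (show k < _ by omega) (show 0 < _ by omega) (h.trans hv0.symm)
    omega
  obtain ⟨q, hq, hvq⟩ := hv.exists_le j
  obtain ⟨q, rfl⟩ : ∃ s, q = s + 1 := Nat.exists_eq_succ_of_ne_zero fun h => hij (by
    rw [← hvq, h, hv0])
  have hlast : v (m + 1) = v 0 := by simpa using hv.1 0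
  have hvLm := hvL m
  rw [hlast] at hvLm
  have hinj (a b : ℕ) (ha : a < m + 1) (hb : b < m + 1) (h : v a = v b) : a = b := hv.2 ha hb h
  have hle := tspCost_le_path p x' (fun k => if k ≤ q then v (k + 1) else
      if k = q + 1 then v 0 else v k) (by
    intro s hs t ht h
    split_ifs at h <;> first
      | omega
      | (have := hinj _ _ (by omega) (by omega) h; omega))
  rw [← hvopt, hv.tourLen_eq]
  have hvL0 := hvL 0
  have e1 : ∑ k ∈ Finset.range q, ‖x' (if k ≤ q then v (k + 1) else
        if k = q + 1 then v 0 else v k) - x' (if k + 1 ≤ q then v (k + 1 + 1) else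
        if k + 1 = q + 1 then v 0 else v (k + 1))‖ ^ p =
      ∑ k ∈ Finset.range q, ‖x (v (k + 1)) - x (v (k + 1 + 1))‖ ^ p := by
    refine Finset.sum_congr rfl fun k hk => ?_
    have hk' := Finset.mem_range.1 hk
    rw [if_pos (by omega), if_pos (by omega), hvi _ (by omega) (by omega),
      hvi _ (by omega) (by omega)]
  rw [if_pos (Nat.zero_le _), zero_add] at hle
  rw [hv0] at hvLm hvL0 hle ⊢
  rw [zero_add] at hvL0
  have h1 := hremove _ _ _ hvLm hvL0
  rcases hq.eq_or_lt with hqm | hqm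
  · have hsplit (f : ℕ → ℝ) : ∑ k ∈ Finset.range m, f k = ∑ k ∈ Finset.range q, f k + f q := by
      rw [← hqm, Finset.sum_range_succ]
    have hsplit' (f : ℕ → ℝ) :
        ∑ k ∈ Finset.range m, f k = ∑ k ∈ Finset.range q, f (k + 1) + f 0 := by
      rw [← hqm, Finset.sum_range_succ']
    rw [hv0] at e1
    rw [hsplit, e1, if_pos le_rfl, if_neg (by omega), if_pos rfl, if_neg (by omega),
      if_pos hqm.symm, hvi _ (by omega) hq, hvi 1 (by omega) (by omega), hvq] at hle
    have hvm : v m = j := by rw [← hvq, hqm]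
    rw [hvm] at h1 hvLm
    rw [hsplit', zero_add, hv0, hvm]
    have h2 := hinsert (x j) (x (v 1)) _ hj
      ((norm_sub_le_norm_sub_add_norm_sub _ (x i) _).trans (by linarith))
    linarith
  · obtain ⟨r, hr⟩ : ∃ r, m = q + 2 + r := Nat.exists_eq_add_of_le hqm
    have hsplit (f : ℕ → ℝ) : ∑ k ∈ Finset.range m, f k = ∑ k ∈ Finset.range q, f k + f q +
        f (q + 1) + ∑ k ∈ Finset.range r, f (q + 2 + k) := by
      rw [hr, Finset.sum_range_add, Finset.sum_range_succ, Finset.sum_range_succ]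
    have hsplit' (f : ℕ → ℝ) : ∑ k ∈ Finset.range m, f k = ∑ k ∈ Finset.range q, f (k + 1) + f 0 +
        f (q + 1) + ∑ k ∈ Finset.range r, f (q + 2 + k) := by
      rw [hr, Finset.sum_range_add, Finset.sum_range_succ, Finset.sum_range_succ']
    have e2 : ∑ k ∈ Finset.range r, ‖x' (if q + 2 + k ≤ q then v (q + 2 + k + 1) else
          if q + 2 + k = q + 1 then v 0 else v (q + 2 + k)) -
          x' (if q + 2 + k + 1 ≤ q then v (q + 2 + k + 1 + 1) else
          if q + 2 + k + 1 = q + 1 then v 0 else v (q + 2 + k + 1))‖ ^ p =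
        ∑ k ∈ Finset.range r, ‖x (v (q + 2 + k)) - x (v (q + 2 + k + 1))‖ ^ p := by
      refine Finset.sum_congr rfl fun k hk => ?_
      have hk' := Finset.mem_range.1 hk
      rw [if_neg (by omega), if_neg (by omega), if_neg (by omega), if_neg (by omega),
        hvi _ (by omega) (by omega), hvi _ (by omega) (by omega)]
    rw [hv0] at e1 e2
    rw [hsplit, e1, e2, if_pos le_rfl, if_neg (by omega), if_pos rfl, if_neg (by omega),
      if_neg (by omega), if_neg (by omega), if_neg (by omega),
      hvi _ (by omega) hq, hvi 1 (by omega) (by omega), hvi _ (by omega) le_rfl,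
      hvi _ (by omega) hqm, hvq] at hle
    have hvLq := hvL (q + 1)
    rw [hvq] at hvLq
    rw [hsplit', zero_add, hv0, hvq]
    have h2 := hinsert (x j) (x (v (q + 1 + 1))) _ hj (hvLq.trans (by linarith))
    linarith

/-- If the points are `δ`-dense in a convex set, then all edges of an optimal tour are `O(δ)`. -/
theorem exists_edge_le {p : ℝ} (hp : 1 < p) (d : ℕ) : ∃ R > 0,
    ∀ {S : Set (EuclideanSpace ℝ (Fin d))}, Convex ℝ S →
    ∀ {m : ℕ} {x : Fin (m + 1) → EuclideanSpace ℝ (Fin d)} {u : ℕ → Fin (m + 1)} {δ : ℝ},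
      (∀ k, x k ∈ S) → 0 < δ → (∀ y ∈ S, ∃ j, ‖x j - y‖ ≤ δ) → IsTour u →
      tourLen p x u = tspCost p x → ∀ k, ‖x (u k) - x (u (k + 1))‖ ≤ R * δ := by
  have hp0 : 0 < p := by linarith
  obtain ⟨t, ht, htp⟩ : ∃ t : ℝ, 1 / 2 < t ∧ 2 * t ^ p < 1 := by
    have hcont : ContinuousAt (fun t : ℝ => 2 * t ^ p) (1 / 2) :=
      continuousAt_const.mul (Real.continuousAt_rpow_const _ _ (Or.inl (by norm_num)))
    have hhalf : 2 * (1 / 2 : ℝ) ^ p < 1 := by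
      have := Real.rpow_lt_rpow_of_exponent_gt (x := 1 / 2) (by norm_num) (by norm_num) hp
      rw [Real.rpow_one] at this
      linarith
    have hev := (hcont.eventually_lt_const hhalf).filter_mono
      (nhdsWithin_le_nhds (s := Set.Ioi (1 / 2)))
    obtain ⟨t, h1, h2⟩ := (hev.and self_mem_nhdsWithin).exists
    exact ⟨t, h2, h1⟩
  have ht0 : 0 < t := by linarith
  have ht1 : t < 1 := by
    by_contra! h
    have := Real.one_le_rpow h hp0.le
    linarith
  obtain ⟨c, hc⟩ : ∃ c, c = (t - 1 / 2) / 2 := ⟨_, rfl⟩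
  have hc0 : 0 < c := by linarith
  have hc4 : c < 1 / 4 := by linarith
  obtain ⟨T, -, hT, hcover⟩ := finite_cover_balls_of_compact
    (isCompact_closedBall (0 : EuclideanSpace ℝ (Fin d)) 2) (show 0 < c / 4 by linarith)
  lift T to Finset (EuclideanSpace ℝ (Fin d)) using hT
  obtain ⟨K, hK⟩ : ∃ K, K = T.card := ⟨_, rfl⟩
  refine ⟨4 * (3 * K + 1) / c, by positivity, ?_⟩
  intro S hS m x u δ hxS hδ hdense hu hopt
  obtain ⟨a, -, ha⟩ := Finset.exists_max_image (Finset.range (m + 1))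
    (fun k => ‖x (u k) - x (u (k + 1))‖) ⟨0, by simp⟩
  have hamax : ∀ k, ‖x (u k) - x (u (k + 1))‖ ≤ ‖x (u a) - x (u (a + 1))‖ := fun k => by
    have := ha (k % (m + 1)) (Finset.mem_range.2 (Nat.mod_lt _ m.succ_pos))
    rwa [hu.succ_eq (hu.eq_mod k), hu.eq_mod] at this
  obtain ⟨L, hL⟩ : ∃ L, L = ‖x (u a) - x (u (a + 1))‖ := ⟨_, rfl⟩
  rw [← hL] at hamax
  suffices hmain : L ≤ 4 * (3 * K + 1) / c * δ from fun k => (hamax k).trans hmain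
  by_contra! hlt
  rw [div_mul_eq_mul_div, div_lt_iff₀ hc0] at hlt
  have hL0 : 0 < L := by
    by_contra! h
    have : 0 < 4 * (3 * K + 1) * δ := by positivity
    nlinarith
  have hcL : 0 < c * L := by positivity
  have hcL4 : c * L < 1 / 4 * L := mul_lt_mul_of_pos_right hc4 hL0
  have htL : t * L = 1 / 2 * L + 2 * (c * L) := by rw [hc]; ring
  have hKδ : 0 ≤ K * δ := by positivity
  have hsmall : 3 * K * δ + δ < c / 4 * L := by linarith
  -- equally spaced points near the midpoint of the longest edge
  obtain ⟨e, he⟩ : ∃ e, e = L⁻¹ • (x (u a) - x (u (a + 1))) := ⟨_, rfl⟩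
  have he1 : ‖e‖ = 1 := by
    rw [he, norm_smul, ← hL, norm_inv, Real.norm_of_nonneg hL0.le, inv_mul_cancel₀ hL0.ne']
  have hLe : x (u a) - x (u (a + 1)) = L • e := by
    rw [he, smul_smul, mul_inv_cancel₀ hL0.ne', one_smul]
  obtain ⟨z, hz⟩ : ∃ z, z = (1 / 2 : ℝ) • (x (u a) + x (u (a + 1))) := ⟨_, rfl⟩
  have hhalf : (L / 2) • e = (1 / 2 : ℝ) • (L • e) := by module
  have hza : x (u a) - z = (L / 2) • e := by
    rw [hz, hhalf, ← hLe]; module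
  have hza' : x (u (a + 1)) - z = -((L / 2) • e) := by
    rw [hz, hhalf, ← hLe]; module
  have hzan : ‖x (u a) - z‖ = L / 2 := by
    rw [hza, norm_smul, he1, mul_one, Real.norm_of_nonneg (by linarith)]
  have hzan' : ‖x (u (a + 1)) - z‖ = L / 2 := by
    rw [hza', norm_neg, norm_smul, he1, mul_one, Real.norm_of_nonneg (by linarith)]
  have hkδ : ∀ k : Fin (K + 1), (k : ℝ) * δ ≤ K * δ := fun k =>
    mul_le_mul_of_nonneg_right (by exact_mod_cast Nat.lt_succ_iff.1 k.2) hδ.le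
  have hyS : ∀ k : Fin (K + 1), z + (3 * δ * k) • e ∈ S := fun k => by
    have h1 : 3 * δ * k / L ≤ 1 / 2 := by
      rw [div_le_iff₀ hL0]; linarith [hkδ k]
    have h0 : 0 ≤ 3 * δ * k / L := by positivity
    have : z + (3 * δ * k) • e = (1 / 2 + 3 * δ * k / L) • x (u a) +
        (1 / 2 - 3 * δ * k / L) • x (u (a + 1)) := by
      rw [hz, he, smul_smul, ← div_eq_mul_inv]; module
    rw [this]
    exact hS (hxS _) (hxS _) (by linarith) (by linarith) (by ring)
  choose i hi using fun k => hdense _ (hyS k)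
  choose b _ hb using fun k => hu.exists_le (i k)
  have hiz : ∀ k, ‖x (i k) - z‖ ≤ c / 4 * L := fun k => by
    have h1 := norm_sub_le_norm_sub_add_norm_sub (x (i k)) (z + (3 * δ * k) • e) z
    rw [add_sub_cancel_left, norm_smul, he1, mul_one, Real.norm_of_nonneg (by positivity)] at h1
    linarith [hi k, hkδ k]
  have hii : ∀ k l, i k = i l → k = l := by
    intro k l h
    by_contra hkl
    have h1 := norm_sub_le_norm_sub_add_norm_sub (z + (3 * δ * k) • e) (x (i k))
      (z + (3 * δ * l) • e)
    rw [norm_sub_rev _ (x (i k))] at h1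
    nth_rewrite 2 [h] at h1
    have h2 : z + (3 * δ * k) • e - (z + (3 * δ * l) • e) = (3 * δ * (k - l)) • e := by module
    rw [h2, norm_smul, he1, mul_one, Real.norm_eq_abs, abs_mul, abs_of_pos (by positivity)] at h1
    have h3 : (1 : ℝ) ≤ |(k : ℝ) - l| := by
      have : (1 : ℤ) ≤ |(k : ℤ) - l| := Int.one_le_abs (by
        intro h0; apply hkl; ext; omega)
      exact_mod_cast this
    have h4 := mul_le_mul_of_nonneg_left h3 hδ.le
    linarith [hi k, hi l]
  -- every edge starting near the midpoint is long
  have hlong : ∀ k, c * L < ‖x (u (b k)) - x (u (b k + 1))‖ := by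
    intro k
    by_contra! hshort
    have hne : u a ≠ u (b k) := fun h => by
      have h1 := hiz k
      rw [← hb, ← h, hzan] at h1
      linarith
    have h2opt := two_opt hu hopt hne
    have hkz := hiz k
    rw [← hb] at hkz
    have h1 : ‖x (u a) - x (u (b k))‖ ≤ t * L := by
      have := norm_sub_le_norm_sub_add_norm_sub (x (u a)) z (x (u (b k)))
      rw [norm_sub_rev z] at this
      linarith
    have h2 : ‖x (u (a + 1)) - x (u (b k + 1))‖ ≤ t * L := by
      have h3 := norm_sub_le_norm_sub_add_norm_sub (x (u (a + 1))) z (x (u (b k + 1)))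
      have h4 := norm_sub_le_norm_sub_add_norm_sub z (x (u (b k))) (x (u (b k + 1)))
      rw [norm_sub_rev z (x (u (b k)))] at h4
      linarith
    have h3 := Real.rpow_le_rpow (norm_nonneg _) h1 hp0.le
    have h4 := Real.rpow_le_rpow (norm_nonneg _) h2 hp0.le
    rw [Real.mul_rpow ht0.le hL0.le] at h3 h4
    rw [← hL] at h2opt
    have h5 : 0 ≤ ‖x (u (b k)) - x (u (b k + 1))‖ ^ p := by positivity
    have h6 := mul_lt_mul_of_pos_right htp (Real.rpow_pos_of_pos hL0 p)
    linarith
  -- two of these edges have both ends close together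
  have hcov : ∀ k, ∃ y ∈ T, ‖L⁻¹ • (x (u (b k + 1)) - z) - y‖ < c / 4 := by
    intro k
    have hmem : L⁻¹ • (x (u (b k + 1)) - z) ∈ closedBall (0 : EuclideanSpace ℝ (Fin d)) 2 := by
      rw [mem_closedBall_zero_iff, norm_smul, norm_inv, Real.norm_of_nonneg hL0.le,
        inv_mul_le_iff₀ hL0]
      have h1 := norm_sub_le_norm_sub_add_norm_sub (x (u (b k + 1))) (x (u (b k))) z
      rw [norm_sub_rev (x (u (b k + 1))) (x (u (b k)))] at h1
      have h2 := hamax (b k)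
      have h3 := hiz k
      rw [← hb] at h3
      linarith
    have := hcover hmem
    simp only [Set.mem_iUnion, mem_ball, dist_eq_norm] at this
    obtain ⟨y, hy, h⟩ := this
    exact ⟨y, hy, h⟩
  choose f hfT hf using hcov
  obtain ⟨k, -, l, -, hkl, hfkl⟩ := Finset.exists_ne_map_eq_of_card_lt_of_maps_to
    (s := (Finset.univ : Finset (Fin (K + 1)))) (t := T) (f := f) (by simp [hK])
    (fun k _ => hfT k)
  have hne : u (b k) ≠ u (b l) := by
    rw [hb, hb]; exact fun h => hkl (hii _ _ h)
  have h2opt := two_opt hu hopt hne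
  have h1 : ‖x (u (b k)) - x (u (b l))‖ ≤ c * L := by
    have := norm_sub_le_norm_sub_add_norm_sub (x (u (b k))) z (x (u (b l)))
    rw [norm_sub_rev z, hb, hb] at this
    rw [hb, hb]
    linarith [hiz k, hiz l]
  have h2 : ‖x (u (b k + 1)) - x (u (b l + 1))‖ ≤ c * L := by
    have h3 := norm_sub_le_norm_sub_add_norm_sub (L⁻¹ • (x (u (b k + 1)) - z)) (f k)
      (L⁻¹ • (x (u (b l + 1)) - z))
    rw [← smul_sub, norm_smul, sub_sub_sub_cancel_right, norm_inv, Real.norm_of_nonneg hL0.le,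
      hfkl, norm_sub_rev (f l), inv_mul_le_iff₀ hL0] at h3
    have h4 := hf k
    rw [hfkl] at h4
    have h5 : L * ‖L⁻¹ • (x (u (b k + 1)) - z) - f l‖ ≤ L * (c / 4) :=
      mul_le_mul_of_nonneg_left h4.le hL0.le
    have h6 := mul_le_mul_of_nonneg_left (hf l).le hL0.le
    linarith
  have h3 := Real.rpow_le_rpow (norm_nonneg _) h1 hp0.le
  have h4 := Real.rpow_le_rpow (norm_nonneg _) h2 hp0.le
  have h5 := Real.rpow_lt_rpow hcL.le (hlong k) hp0
  have h6 := Real.rpow_lt_rpow hcL.le (hlong l) hp0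
  linarith

/-- Changing one point changes the optimal cost by `O(δ ^ p)`, provided that the remaining points
are `δ`-dense. -/
theorem exists_tspCost_le_of_dense {p : ℝ} (hp : 1 ≤ p) (d : ℕ) : ∃ B > 0,
    ∀ {S : Set (EuclideanSpace ℝ (Fin d))}, Convex ℝ S →
    ∀ {m : ℕ} {x x' : Fin (m + 1) → EuclideanSpace ℝ (Fin d)} {i : Fin (m + 1)} {δ : ℝ},
      (∀ k, x k ∈ S) → x' i ∈ S → (∀ k ≠ i, x' k = x k) → 0 < δ →
      (∀ y ∈ S, ∃ j ≠ i, ‖x j - y‖ ≤ δ) → tspCost p x' ≤ tspCost p x + B * δ ^ p := by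
  have hp0 : 0 < p := by linarith
  rcases hp.eq_or_lt with rfl | hp
  · refine ⟨4, by norm_num, ?_⟩
    intro S hS m x x' i δ hxS hx'S hxx' hδ hdense
    obtain ⟨u, hu, hopt⟩ := exists_tour_eq_tspCost 1 x
    obtain ⟨j, hji, hj⟩ := hdense _ hx'S
    obtain ⟨a, -, ha⟩ := Finset.exists_max_image (Finset.univ)
      (fun k : Fin (m + 1) × Fin (m + 1) => ‖x k.1 - x k.2‖) ⟨(0, 0), by simp⟩
    have := tspCost_le_of_move hu hopt hji hxx' hj (fun k => ha (u k, u (k + 1)) (by simp))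
      (B := 2 * δ) (fun a b y _ _ => by
        simp only [Real.rpow_one]
        linarith [norm_sub_le_norm_sub_add_norm_sub a y b]) (fun a b y h _ => by
        simp only [Real.rpow_one]
        have := norm_sub_le_norm_sub_add_norm_sub y a b
        rw [norm_sub_rev y a] at this
        linarith)
    rw [Real.rpow_one]
    linarith
  · obtain ⟨R, hR, hedge⟩ := exists_edge_le hp d
    refine ⟨2 * (1 + (1 + 2 * R) ^ p), by positivity, ?_⟩
    intro S hS m x x' i δ hxS hx'S hxx' hδ hdense
    obtain ⟨u, hu, hopt⟩ := exists_tour_eq_tspCost p x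
    obtain ⟨j, hji, hj⟩ := hdense _ hx'S
    have := tspCost_le_of_move hu hopt hji hxx' hj
      (hedge hS hxS hδ (fun y hy => (hdense y hy).imp fun _ h => h.2) hu hopt)
      (B := (1 + (1 + 2 * R) ^ p) * δ ^ p) (fun a b y h1 h2 => by
        have h3 : ‖a - b‖ ≤ (1 + 2 * R) * δ := by
          linarith [norm_sub_le_norm_sub_add_norm_sub a y b]
        have h4 := Real.rpow_le_rpow (norm_nonneg _) h3 hp0.le
        rw [Real.mul_rpow (by positivity) hδ.le] at h4
        have h5 : 0 ≤ ‖a - y‖ ^ p := by positivity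
        have h6 : 0 ≤ ‖y - b‖ ^ p := by positivity
        have h7 : 0 ≤ δ ^ p := by positivity
        linarith) (fun a b y h1 h2 => by
        have h3 : ‖y - b‖ ≤ (1 + 2 * R) * δ := by
          have := norm_sub_le_norm_sub_add_norm_sub y a b
          rw [norm_sub_rev y a] at this
          linarith
        have h4 := Real.rpow_le_rpow (norm_nonneg _) h3 hp0.le
        rw [Real.mul_rpow (by positivity) hδ.le] at h4
        have h5 := Real.rpow_le_rpow (norm_nonneg _) h1 hp0.le
        have h6 : 0 ≤ ‖a - b‖ ^ p := by positivity
        linarith)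
    linarith

end Tours

theorem integrable_of_abs_le {Ω : Type*} [MeasurableSpace Ω] {μ : Measure Ω} [IsFiniteMeasure μ]
    {f : Ω → ℝ} {M : ℝ} (hf : Measurable f) (hM : ∀ x, |f x| ≤ M) : Integrable f μ :=
  Integrable.of_bound hf.aestronglyMeasurable M (ae_of_all _ hM)

theorem sq_integral_le {Ω : Type*} [MeasurableSpace Ω] {μ : Measure Ω} [IsProbabilityMeasure μ]
    {f : Ω → ℝ} {M : ℝ} (hf : Measurable f) (hM : ∀ x, |f x| ≤ M) :
    (∫ x, f x ∂μ) ^ 2 ≤ ∫ x, f x ^ 2 ∂μ := by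
  have h := ProbabilityTheory.variance_eq_sub (X := f) (μ := μ)
    (MemLp.of_bound hf.aestronglyMeasurable M (ae_of_all _ hM))
  have h0 := ProbabilityTheory.variance_nonneg f μ
  simp only [Pi.pow_apply] at h
  linarith

/-- The **Efron–Stein inequality** for bounded functions, in the form where `g i` is an arbitrary
function not depending on the `i`-th coordinate. -/
theorem efron_stein {α : Type*} [MeasurableSpace α] (μ : Measure α) [IsProbabilityMeasure μ]
    {n : ℕ} {f : (Fin n → α) → ℝ} {g : Fin n → (Fin n → α) → ℝ} {M : ℝ}
    (hf : Measurable f) (hfM : ∀ x, |f x| ≤ M) (hg : ∀ i, Measurable (g i))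
    (hgM : ∀ i x, |g i x| ≤ M) (hupd : ∀ i x a, g i (Function.update x i a) = g i x) :
    ∫ x, f x ^ 2 ∂(Measure.pi fun _ => μ) - (∫ x, f x ∂(Measure.pi fun _ => μ)) ^ 2 ≤
      ∑ i, ∫ x, (f x - g i x) ^ 2 ∂(Measure.pi fun _ => μ) := by
  induction n with
  | zero =>
    have h : ∀ x, f x = f default := fun x => congrArg f (Subsingleton.elim _ _)
    simp [h]
  | succ n ih =>
    obtain ⟨ν, hν⟩ : ∃ ν : Measure (Fin n → α), ν = Measure.pi fun _ => μ := ⟨_, rfl⟩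
    have : IsProbabilityMeasure ν := by rw [hν]; infer_instance
    have hcons : Measurable fun z : α × (Fin n → α) => (Fin.cons z.1 z.2 : Fin (n + 1) → α) := by
      refine measurable_pi_lambda _ fun i => ?_
      refine Fin.cases ?_ (fun j => ?_) i
      · simpa using measurable_fst
      · simp only [Fin.cons_succ]
        exact (measurable_pi_apply j).comp measurable_snd
    have hint (h : (Fin (n + 1) → α) → ℝ) :
        ∫ x, h x ∂(Measure.pi fun _ => μ) = ∫ z, h (Fin.cons z.1 z.2) ∂(μ.prod ν) := by
      rw [hν]
      refine ((measurePreserving_piFinSuccAbove (fun _ : Fin (n + 1) => μ) 0).symm.integral_comp'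
        h).symm.trans ?_
      congr 1
      funext z
      simp [MeasurableEquiv.piFinSuccAbove]
      rfl
    have hM : 0 ≤ M := (abs_nonneg _).trans (hfM fun _ => Classical.choice
      (Measure.nonempty_of_neZero μ))
    have hsq {s : ℝ} (hs : |s| ≤ M) : |s ^ 2| ≤ M ^ 2 := by
      rw [abs_pow]; exact pow_le_pow_left₀ (abs_nonneg _) hs 2
    have hsq' {s t : ℝ} (hs : |s| ≤ M) (ht : |t| ≤ M) : |(s - t) ^ 2| ≤ (2 * M) ^ 2 := by
      rw [abs_pow]
      exact pow_le_pow_left₀ (abs_nonneg _) ((abs_sub _ _).trans (by linarith)) 2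
    have hF : Measurable fun z : α × (Fin n → α) => f (Fin.cons z.1 z.2) := hf.comp hcons
    have hG (i) : Measurable fun z : α × (Fin n → α) => g i (Fin.cons z.1 z.2) :=
      (hg i).comp hcons
    have hFs (a : α) : Measurable fun y : Fin n → α => f (Fin.cons a y) :=
      hF.comp measurable_prodMk_left
    have hGs (i) (a : α) : Measurable fun y : Fin n → α => g i (Fin.cons a y) :=
      (hG i).comp measurable_prodMk_left
    have hh : Measurable fun a => ∫ y, f (Fin.cons a y) ∂ν :=
      hF.stronglyMeasurable.integral_prod_right'.measurable
    have hhM (a : α) : |∫ y, f (Fin.cons a y) ∂ν| ≤ M := by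
      simpa using norm_integral_le_of_norm_le_const (μ := ν) (f := fun y => f (Fin.cons a y))
        (C := M) (ae_of_all _ fun y => hfM _)
    have hint_sub (i) : Integrable (fun z : α × (Fin n → α) =>
        (f (Fin.cons z.1 z.2) - g i (Fin.cons z.1 z.2)) ^ 2) (μ.prod ν) :=
      integrable_of_abs_le ((hF.sub (hG i)).pow_const 2) fun z => hsq' (hfM _) (hgM _ _)
    have hint_sq : Integrable (fun z : α × (Fin n → α) => f (Fin.cons z.1 z.2) ^ 2) (μ.prod ν) :=
      integrable_of_abs_le (hF.pow_const 2) fun z => hsq (hfM _)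
    have hint_hsq : Integrable (fun a => (∫ y, f (Fin.cons a y) ∂ν) ^ 2) μ :=
      integrable_of_abs_le (hh.pow_const 2) fun z => hsq (hhM _)
    -- variance in the last coordinates
    have htail : ∫ a, ∫ y, f (Fin.cons a y) ^ 2 ∂ν ∂μ - ∫ a, (∫ y, f (Fin.cons a y) ∂ν) ^ 2 ∂μ ≤
        ∑ i : Fin n, ∫ a, ∫ y, (f (Fin.cons a y) - g i.succ (Fin.cons a y)) ^ 2 ∂ν ∂μ := by
      rw [← integral_sub hint_sq.integral_prod_left hint_hsq,
        ← integral_finsetSum _ fun i _ => (hint_sub _).integral_prod_left]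
      refine integral_mono (hint_sq.integral_prod_left.sub hint_hsq)
        (integrable_finsetSum _ fun i _ => (hint_sub _).integral_prod_left) fun a => ?_
      have := ih (f := fun y => f (Fin.cons a y)) (g := fun i y => g i.succ (Fin.cons a y)) (hFs a)
        (fun y => hfM _) (fun i => hGs _ a) (fun i y => hgM _ _) (fun i y b => by
          rw [Fin.cons_update, hupd])
      rw [← hν] at this
      exact this
    -- variance in the first coordinate
    have hhead : ∫ a, (∫ y, f (Fin.cons a y) ∂ν) ^ 2 ∂μ - (∫ a, ∫ y, f (Fin.cons a y) ∂ν ∂μ) ^ 2 ≤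
        ∫ a, ∫ y, (f (Fin.cons a y) - g 0 (Fin.cons a y)) ^ 2 ∂ν ∂μ := by
      obtain ⟨a₀⟩ := Measure.nonempty_of_neZero μ
      obtain ⟨c, hc⟩ : ∃ c, c = ∫ y, g 0 (Fin.cons a₀ y) ∂ν := ⟨_, rfl⟩
      have hcM : |c| ≤ M := by
        rw [hc]
        simpa using norm_integral_le_of_norm_le_const (μ := ν)
          (f := fun y => g 0 (Fin.cons a₀ y)) (C := M) (ae_of_all _ fun y => hgM _ _)
      have hc' (a : α) : ∫ y, g 0 (Fin.cons a y) ∂ν = c := by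
        rw [hc]
        congr 1
        funext y
        have := hupd 0 (Fin.cons a₀ y) a
        rw [Fin.update_cons_zero] at this
        exact this
      have hvar := sq_integral_le (μ := μ) (hh.sub_const c) fun a =>
        (abs_sub _ _).trans (add_le_add (hhM a) hcM)
      have hhint : Integrable (fun a => ∫ y, f (Fin.cons a y) ∂ν) μ := integrable_of_abs_le hh hhM
      have hexp : ∫ a, ((∫ y, f (Fin.cons a y) ∂ν) - c) ^ 2 ∂μ =
          ∫ a, (∫ y, f (Fin.cons a y) ∂ν) ^ 2 ∂μ - 2 * c * ∫ a, ∫ y, f (Fin.cons a y) ∂ν ∂μ +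
            c ^ 2 := by
        have h (a) : ((∫ y, f (Fin.cons a y) ∂ν) - c) ^ 2 =
            (∫ y, f (Fin.cons a y) ∂ν) ^ 2 - 2 * c * (∫ y, f (Fin.cons a y) ∂ν) + c ^ 2 := by
          ring
        have hsub : Integrable (fun a => (∫ y, f (Fin.cons a y) ∂ν) ^ 2 -
            2 * c * (∫ y, f (Fin.cons a y) ∂ν)) μ := hint_hsq.sub (hhint.const_mul _)
        simp only [h]
        rw [integral_add hsub (integrable_const _),
          integral_sub hint_hsq (hhint.const_mul _), integral_const_mul]
        simp
      rw [integral_sub hhint (integrable_const _)] at hvar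
      simp only [integral_const, probReal_univ, one_smul] at hvar
      have hle : ∫ a, ((∫ y, f (Fin.cons a y) ∂ν) - c) ^ 2 ∂μ ≤
          ∫ a, ∫ y, (f (Fin.cons a y) - g 0 (Fin.cons a y)) ^ 2 ∂ν ∂μ := by
        refine integral_mono (integrable_of_abs_le ((hh.sub_const c).pow_const 2)
          fun a => hsq' (hhM a) hcM) (hint_sub 0).integral_prod_left fun a => ?_
        have := sq_integral_le (μ := ν) ((hFs a).sub (hGs 0 a)) fun y =>
          (abs_sub _ _).trans (add_le_add (hfM _) (hgM _ _))
        simp only [Pi.sub_apply] at this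
        rw [integral_sub (integrable_of_abs_le (hFs a) fun y => hfM _)
          (integrable_of_abs_le (hGs 0 a) fun y => hgM _ _), hc'] at this
        exact this
      have hvar' : 0 ≤ ((∫ a, ∫ y, f (Fin.cons a y) ∂ν ∂μ) - c) ^ 2 := sq_nonneg _
      linarith
    rw [hint, hint, integral_prod _ hint_sq,
      integral_prod _ (integrable_of_abs_le hF fun z => hfM _), Fin.sum_univ_succ]
    simp only [hint]
    rw [integral_prod _ (hint_sub 0),
      Finset.sum_congr rfl fun i _ => integral_prod _ (hint_sub (Fin.succ i))]
    linarith

/-! ### The uniform measure on the cube -/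

/-- The axis-parallel box with side `1 / N` and lower corner `q / N`. -/
def gridCell {d : ℕ} (N : ℕ) (q : Fin d → ℕ) : Set (EuclideanSpace ℝ (Fin d)) :=
  {y | ∀ k, y k ∈ Set.Icc ((q k : ℝ) / N) ((q k + 1) / N)}

theorem gridCell_eq_preimage {d : ℕ} (N : ℕ) (q : Fin d → ℕ) :
    gridCell N q = (@WithLp.ofLp 2 (Fin d → ℝ)) ⁻¹'
      Set.pi Set.univ fun k => Set.Icc ((q k : ℝ) / N) ((q k + 1) / N) := by
  ext y
  simp [gridCell, -Set.pi_univ_Icc]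

theorem measurableSet_gridCell {d : ℕ} (N : ℕ) (q : Fin d → ℕ) :
    MeasurableSet (gridCell N q) := by
  rw [gridCell_eq_preimage]
  exact (PiLp.volume_preserving_ofLp (Fin d)).measurable
    (MeasurableSet.univ_pi fun _ => measurableSet_Icc)

theorem volume_gridCell {d : ℕ} (N : ℕ) (q : Fin d → ℕ) :
    volume (gridCell N q) = ENNReal.ofReal ((N ^ d : ℕ) : ℝ)⁻¹ := by
  rw [gridCell_eq_preimage, (PiLp.volume_preserving_ofLp (Fin d)).measure_preimage
    (MeasurableSet.univ_pi fun _ => measurableSet_Icc).nullMeasurableSet, volume_pi_pi]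
  have h (k : Fin d) : ((q k : ℝ) + 1) / N - q k / N = (N : ℝ)⁻¹ := by ring
  simp only [Real.volume_Icc, h, Finset.prod_const, Finset.card_univ, Fintype.card_fin]
  rw [← ENNReal.ofReal_pow (by positivity)]
  simp

theorem unitCube_eq_gridCell (d : ℕ) : unitCube d = gridCell 1 0 := by
  ext y
  simp [unitCube, gridCell]

theorem measurableSet_unitCube (d : ℕ) : MeasurableSet (unitCube d) :=
  unitCube_eq_gridCell d ▸ measurableSet_gridCell 1 0

instance isProbabilityMeasure_cubeUniform (d : ℕ) : IsProbabilityMeasure (cubeUniform d) := by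
  refine ⟨?_⟩
  rw [cubeUniform, Measure.restrict_apply_univ, unitCube_eq_gridCell, volume_gridCell]
  simp

theorem convex_unitCube (d : ℕ) : Convex ℝ (unitCube d) := by
  intro x hx y hy a b ha hb hab k
  exact convex_Icc (0 : ℝ) 1 (hx k) (hy k) ha hb hab

theorem zero_mem_unitCube (d : ℕ) : (0 : EuclideanSpace ℝ (Fin d)) ∈ unitCube d := by
  simp [unitCube]

theorem gridCell_subset_unitCube {d N : ℕ} (q : Fin d → Fin N) :
    gridCell N (fun k => (q k : ℕ)) ⊆ unitCube d := by
  intro y hy k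
  have hN : (0 : ℝ) < N := by exact_mod_cast (q k).pos
  refine ⟨le_trans (by positivity) (hy k).1, (hy k).2.trans ?_⟩
  rw [div_le_one hN]
  exact_mod_cast (q k).isLt

theorem exists_mem_gridCell {d N : ℕ} (hN : 0 < N) {y : EuclideanSpace ℝ (Fin d)}
    (hy : y ∈ unitCube d) : ∃ q : Fin d → Fin N, y ∈ gridCell N (fun k => (q k : ℕ)) := by
  have hN' : (0 : ℝ) < N := by exact_mod_cast hN
  have h (k : Fin d) : ∃ q : Fin N, y k ∈ Set.Icc ((q : ℕ) / N : ℝ) (((q : ℕ) + 1) / N) := by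
    obtain ⟨h0, h1⟩ := hy k
    rcases lt_or_ge ⌊(N : ℝ) * y k⌋₊ N with h | h
    · refine ⟨⟨_, h⟩, ?_, ?_⟩
      · rw [div_le_iff₀ hN']
        exact (Nat.floor_le (by positivity)).trans_eq (mul_comm _ _)
      · rw [le_div_iff₀ hN']
        exact (mul_comm _ _).trans_le (Nat.lt_floor_add_one _).le
    · have hle : (N : ℝ) ≤ N * y k := (Nat.le_floor_iff (by positivity)).1 h
      have hy1 : y k = 1 := le_antisymm h1 (by nlinarith)
      refine ⟨⟨N - 1, by omega⟩, ?_⟩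
      rw [hy1, Nat.cast_sub (by omega : 1 ≤ N)]
      constructor
      · rw [div_le_one hN']; simp
      · rw [le_div_iff₀ hN']; simp
  choose q hq using h
  exact ⟨q, hq⟩

theorem norm_sub_le_of_mem_gridCell {d N : ℕ} {q : Fin d → ℕ} {x y : EuclideanSpace ℝ (Fin d)}
    (hx : x ∈ gridCell N q) (hy : y ∈ gridCell N q) : ‖x - y‖ ≤ √d / N := by
  have h (k : Fin d) : ‖(x - y) k‖ ^ 2 ≤ ((N : ℝ)⁻¹) ^ 2 := by
    refine pow_le_pow_left₀ (norm_nonneg _) ?_ 2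
    have e : ((q k : ℝ) + 1) / N - q k / N = (N : ℝ)⁻¹ := by ring
    rw [PiLp.sub_apply, Real.norm_eq_abs, abs_sub_le_iff]
    constructor <;> linarith [(hx k).1, (hx k).2, (hy k).1, (hy k).2]
  rw [EuclideanSpace.norm_eq]
  refine (Real.sqrt_le_sqrt (Finset.sum_le_sum fun k _ => h k)).trans_eq ?_
  rw [Finset.sum_const, Finset.card_univ, Fintype.card_fin, nsmul_eq_mul,
    Real.sqrt_mul (by positivity), Real.sqrt_sq (by positivity), div_eq_mul_inv]

theorem norm_sub_le_of_mem_unitCube {d : ℕ} {x y : EuclideanSpace ℝ (Fin d)}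
    (hx : x ∈ unitCube d) (hy : y ∈ unitCube d) : ‖x - y‖ ≤ √d := by
  rw [unitCube_eq_gridCell] at hx hy
  simpa using norm_sub_le_of_mem_gridCell hx hy

theorem ae_mem_unitCube (d n : ℕ) :
    ∀ᵐ x ∂(Measure.pi fun _ : Fin n => cubeUniform d), ∀ k, x k ∈ unitCube d := by
  refine ae_all_iff.2 fun k => ?_
  exact (Measure.quasiMeasurePreserving_eval (fun _ : Fin n => cubeUniform d) k).ae
    (ae_restrict_mem (measurableSet_unitCube d))

/-- With high probability the points other than the `i`-th one are `√d / N`-dense in the cube. -/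
theorem exists_sparse_set {d m N : ℕ} (hN : 0 < N) (i : Fin (m + 1)) :
    ∃ A : Set (Fin (m + 1) → EuclideanSpace ℝ (Fin d)), MeasurableSet A ∧
      (Measure.pi fun _ => cubeUniform d).real A ≤
        (N ^ d : ℕ) * (1 - ((N ^ d : ℕ) : ℝ)⁻¹) ^ m ∧
      ∀ x ∉ A, ∀ y ∈ unitCube d, ∃ j ≠ i, ‖x j - y‖ ≤ √d / N := by
  obtain ⟨cell, hcell⟩ : ∃ cell : (Fin d → Fin N) → Set (EuclideanSpace ℝ (Fin d)),
    cell = fun q => gridCell N fun k => (q k : ℕ) := ⟨_, rfl⟩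
  have hmeas (q) : MeasurableSet (cell q) := by rw [hcell]; exact measurableSet_gridCell _ _
  obtain ⟨box, hbox⟩ : ∃ box : (Fin d → Fin N) → Fin (m + 1) → Set (EuclideanSpace ℝ (Fin d)),
    box = fun q j => if j = i then Set.univ else (cell q)ᶜ := ⟨_, rfl⟩
  have hboxm (q j) : MeasurableSet (box q j) := by
    rw [hbox]
    dsimp only
    split_ifs
    exacts [MeasurableSet.univ, (hmeas q).compl]
  have hprob (q) : (cubeUniform d).real (cell q)ᶜ = 1 - ((N ^ d : ℕ) : ℝ)⁻¹ := by
    rw [measureReal_compl (hmeas q), probReal_univ, measureReal_def, cubeUniform,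
      Measure.restrict_apply (hmeas q), hcell,
      Set.inter_eq_left.2 (gridCell_subset_unitCube q), volume_gridCell,
      ENNReal.toReal_ofReal (by positivity)]
  refine ⟨⋃ q, Set.pi Set.univ (box q),
    MeasurableSet.iUnion fun q => MeasurableSet.univ_pi (hboxm q), ?_, ?_⟩
  · refine (measureReal_iUnion_fintype_le _).trans ?_
    have h (q) : (Measure.pi fun _ => cubeUniform d).real (Set.pi Set.univ (box q)) =
        (1 - ((N ^ d : ℕ) : ℝ)⁻¹) ^ m := by
      rw [measureReal_def, Measure.pi_pi, ENNReal.toReal_prod]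
      simp only [← measureReal_def]
      rw [Fin.prod_univ_succAbove _ i, hbox]
      simp [Fin.succAbove_ne, hprob]
    simp [h]
  · intro x hx y hy
    obtain ⟨q, hq⟩ := exists_mem_gridCell hN hy
    have hxq : x ∉ Set.pi Set.univ (box q) := fun h => hx (Set.mem_iUnion.2 ⟨q, h⟩)
    simp only [Set.mem_pi, Set.mem_univ, true_imp_iff, not_forall] at hxq
    obtain ⟨j, hj⟩ := hxq
    rw [hbox] at hj
    by_cases hji : j = i
    · simp [hji] at hj
    · simp only [hji, if_false, Set.mem_compl_iff, not_not] at hj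
      rw [hcell] at hj
      exact ⟨j, hji, norm_sub_le_of_mem_gridCell hj hq⟩

/-! ### Choice of the grid size -/

theorem one_sub_inv_pow_le_exp {D : ℝ} (hD : 1 ≤ D) (m : ℕ) :
    (1 - D⁻¹) ^ m ≤ Real.exp 1 * Real.exp (-((m + 1 : ℕ) / D)) := by
  have hD0 : 0 < D := by linarith
  have h1 : D⁻¹ ≤ 1 := inv_le_one_of_one_le₀ hD
  calc (1 - D⁻¹) ^ m ≤ Real.exp (-D⁻¹) ^ m :=
        pow_le_pow_left₀ (by linarith) (Real.one_sub_le_exp_neg _) m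
    _ = Real.exp (m * -D⁻¹) := (Real.exp_nat_mul _ _).symm
    _ ≤ Real.exp (1 + -((m + 1 : ℕ) / D)) := by
        apply Real.exp_le_exp.2
        rw [div_eq_mul_inv]
        push_cast
        linarith
    _ = _ := Real.exp_add _ _

theorem exp_neg_rpow_le {ε : ℝ} (hε : 0 < ε) (b : ℝ) :
    ∃ C > 0, ∀ t : ℝ, 1 ≤ t → Real.exp (-t ^ ε) ≤ C * t ^ b := by
  obtain ⟨k, hk⟩ := exists_nat_ge (-b / ε)
  refine ⟨k.factorial, by positivity, fun t ht => ?_⟩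
  have ht0 : 0 < t := by linarith
  have h := Real.pow_div_factorial_le_exp (t ^ ε) (by positivity) k
  rw [Real.exp_neg, inv_le_comm₀ (Real.exp_pos _) (by positivity)]
  refine le_trans ?_ h
  rw [mul_inv, div_eq_inv_mul, ← Real.rpow_neg ht0.le, ← Real.rpow_natCast, ← Real.rpow_mul ht0.le]
  gcongr
  rw [div_le_iff₀ hε] at hk
  linarith

theorem exists_grid_size {d : ℕ} (hd : 1 ≤ d) {p : ℝ} (hp : 1 ≤ p) :
    ∃ C > 0, ∀ m : ℕ, ∃ N : ℕ, 0 < N ∧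
      (((N : ℝ)⁻¹) ^ p) ^ 2 ≤ C * ((m + 1 : ℕ) : ℝ) ^ (1 / 2 - 2 * p / d) ∧
      ((m + 1 : ℕ) : ℝ) ^ 2 * ((N ^ d : ℕ) * (1 - ((N ^ d : ℕ) : ℝ)⁻¹) ^ m) ≤
        C * ((m + 1 : ℕ) : ℝ) ^ (1 / 2 - 2 * p / d) := by
  have hd0 : (0 : ℝ) < d := by exact_mod_cast hd
  obtain ⟨ε, hε⟩ : ∃ ε : ℝ, ε = d / (4 * p + d) := ⟨_, rfl⟩
  have hε0 : 0 < ε := by rw [hε]; positivity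
  have hε1 : ε ≤ 1 := by rw [hε, div_le_one (by positivity)]; linarith
  have hεp : 2 * ε * p / d ≤ 1 / 2 := by
    rw [hε, div_le_div_iff₀ hd0 two_pos, mul_div_assoc', div_mul_eq_mul_div, div_mul_eq_mul_div,
      div_le_iff₀ (by positivity)]
    nlinarith
  obtain ⟨C, hC0, hC⟩ := exp_neg_rpow_le hε0 (1 / 2 - 2 * p / d - 3)
  refine ⟨max (4 ^ p) (Real.exp 1 * C), by positivity, fun m => ?_⟩
  obtain ⟨t, ht⟩ : ∃ t : ℝ, t = ((m + 1 : ℕ) : ℝ) := ⟨_, rfl⟩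
  have ht1 : 1 ≤ t := by rw [ht]; push_cast; linarith [Nat.cast_nonneg (α := ℝ) m]
  have ht0 : 0 < t := by linarith
  obtain ⟨s, hs⟩ : ∃ s : ℝ, s = t ^ ((1 - ε) / d) := ⟨_, rfl⟩
  have hs1 : 1 ≤ s := by
    rw [hs]
    exact Real.one_le_rpow ht1 (div_nonneg (by linarith) hd0.le)
  have hN1 : 1 ≤ ⌊s⌋₊ := (Nat.le_floor_iff (by linarith)).2 (by simpa using hs1)
  have hNs : (⌊s⌋₊ : ℝ) ≤ s := Nat.floor_le (by linarith)
  have hsN : s / 2 ≤ ⌊s⌋₊ := by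
    have h1 := Nat.lt_floor_add_one s
    have h2 : (1 : ℝ) ≤ ⌊s⌋₊ := by exact_mod_cast hN1
    linarith
  refine ⟨⌊s⌋₊, hN1, ?_, ?_⟩
  · rw [← ht]
    have h1 : ((⌊s⌋₊ : ℝ))⁻¹ ≤ 2 * s⁻¹ := by
      rw [inv_le_comm₀ (by positivity) (by positivity)]
      refine le_of_eq_of_le ?_ hsN
      field_simp
    calc ((((⌊s⌋₊ : ℝ))⁻¹) ^ p) ^ 2 ≤ ((2 * s⁻¹) ^ p) ^ 2 := by gcongr
      _ = 4 ^ p * t ^ ((1 - ε) / d * -(2 * p)) := by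
        rw [Real.rpow_mul ht0.le, ← hs, Real.mul_rpow two_pos.le (by positivity), mul_pow,
          Real.inv_rpow (by linarith), ← Real.rpow_neg (by linarith), ← Real.rpow_natCast,
          ← Real.rpow_natCast, ← Real.rpow_mul two_pos.le, ← Real.rpow_mul (by linarith),
          show (4 : ℝ) = 2 ^ (2 : ℝ) by norm_num, ← Real.rpow_mul two_pos.le]
        congr 2 <;> push_cast <;> ring
      _ ≤ max (4 ^ p) (Real.exp 1 * C) * t ^ (1 / 2 - 2 * p / d) := by
        gcongr
        · exact le_max_left _ _
        · have : (1 - ε) / d * -(2 * p) = 2 * ε * p / d - 2 * p / d := by ring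
          linarith
  · obtain ⟨D, hD⟩ : ∃ D : ℝ, D = ((⌊s⌋₊ ^ d : ℕ) : ℝ) := ⟨_, rfl⟩
    have hD1 : 1 ≤ D := by rw [hD]; exact_mod_cast Nat.one_le_pow _ _ hN1
    have hDt : D ≤ t ^ (1 - ε) := by
      have : t ^ (1 - ε) = s ^ d := by
        rw [hs, ← Real.rpow_natCast, ← Real.rpow_mul ht0.le, div_mul_cancel₀ _ hd0.ne']
      rw [this, hD]
      push_cast
      gcongr
    have hDt' : D ≤ t := hDt.trans (by
      simpa using Real.rpow_le_rpow_of_exponent_le ht1 (by linarith : 1 - ε ≤ 1))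
    have hexp : (1 - D⁻¹) ^ m ≤ Real.exp 1 * Real.exp (-t ^ ε) := by
      refine (one_sub_inv_pow_le_exp hD1 m).trans ?_
      rw [← ht]
      gcongr
      rw [le_div_iff₀ (by linarith)]
      calc t ^ ε * D ≤ t ^ ε * t ^ (1 - ε) := by gcongr
        _ = t := by rw [← Real.rpow_add ht0]; simp
    rw [← ht, ← hD]
    calc t ^ 2 * (D * (1 - D⁻¹) ^ m)
        ≤ t ^ 2 * (t * (Real.exp 1 * (C * t ^ (1 / 2 - 2 * p / d - 3)))) := by
          have := hC t ht1
          have h0 : 0 ≤ (1 - D⁻¹) ^ m :=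
            pow_nonneg (sub_nonneg.2 (inv_le_one_of_one_le₀ hD1)) m
          gcongr
          exact hexp.trans (by gcongr)
      _ = Real.exp 1 * C * t ^ (1 / 2 - 2 * p / d) := by
          rw [Real.rpow_sub ht0 _ 3, show (t ^ (3 : ℝ)) = t ^ 3 by norm_cast]
          field_simp
      _ ≤ _ := by
          gcongr
          exact le_max_right _ _

/-! ### Variance bound -/

theorem tspCost_nonneg {d n : ℕ} (p : ℝ) (x : Fin n → EuclideanSpace ℝ (Fin d)) :
    0 ≤ tspCost p x :=
  Real.iInf_nonneg fun _ => Finset.sum_nonneg fun _ _ => Real.rpow_nonneg (norm_nonneg _) _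

theorem measurable_tspCost {d n : ℕ} {p : ℝ} (hp : 1 ≤ p) :
    Measurable fun x : Fin n → EuclideanSpace ℝ (Fin d) => tspCost p x := by
  refine Measurable.iInf fun τ => Continuous.measurable ?_
  unfold tspLen
  exact continuous_finsetSum _ fun k _ => Continuous.rpow_const (by fun_prop)
    fun _ => Or.inr (by linarith)

theorem tspCost_le_of_mem_unitCube {d n : ℕ} {p : ℝ} (hp : 1 ≤ p)
    {x : Fin n → EuclideanSpace ℝ (Fin d)} (hx : ∀ k, x k ∈ unitCube d) :
    tspCost p x ≤ n * √d ^ p := by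
  refine (tspCost_le_tspLen p x 1).trans ((Finset.sum_le_sum fun k _ =>
    Real.rpow_le_rpow (norm_nonneg _) (norm_sub_le_of_mem_unitCube (hx _) (hx _))
      (by linarith)).trans_eq ?_)
  simp

/-- The cost truncated at its maximal value on the cube. -/
noncomputable def truncatedCost {d n : ℕ} (p : ℝ) (x : Fin n → EuclideanSpace ℝ (Fin d)) : ℝ :=
  min (tspCost p x) (n * √d ^ p)

theorem measurable_truncatedCost {d n : ℕ} {p : ℝ} (hp : 1 ≤ p) :
    Measurable fun x : Fin n → EuclideanSpace ℝ (Fin d) => truncatedCost p x :=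
  (measurable_tspCost hp).min measurable_const

theorem truncatedCost_mem_Icc {d n : ℕ} (p : ℝ) (x : Fin n → EuclideanSpace ℝ (Fin d)) :
    truncatedCost p x ∈ Set.Icc 0 (n * √d ^ p) :=
  ⟨le_min (tspCost_nonneg p x) (by positivity), min_le_right _ _⟩

theorem abs_truncatedCost_le {d n : ℕ} (p : ℝ) (x : Fin n → EuclideanSpace ℝ (Fin d)) :
    |truncatedCost p x| ≤ n * √d ^ p := by
  obtain ⟨h0, h1⟩ := truncatedCost_mem_Icc p x
  rwa [abs_of_nonneg h0]

theorem ae_truncatedCost_eq (d n : ℕ) {p : ℝ} (hp : 1 ≤ p) :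
    (fun x => tspCost p x) =ᵐ[Measure.pi fun _ : Fin n => cubeUniform d]
      fun x => truncatedCost p x := by
  filter_upwards [ae_mem_unitCube d n] with x hx
  exact (min_eq_left (tspCost_le_of_mem_unitCube hp hx)).symm

/-- The influence of a single point on the cost. -/
theorem exists_integral_sq_sub_update_le {p : ℝ} (hp : 1 ≤ p) (d : ℕ) :
    ∃ B > 0, ∀ (m N : ℕ) (i : Fin (m + 1)), 0 < N →
      ∫ x, (truncatedCost p x - truncatedCost p (Function.update x i 0)) ^ 2
          ∂(Measure.pi fun _ : Fin (m + 1) => cubeUniform d) ≤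
        (B * (√d / N) ^ p) ^ 2 + (((m + 1 : ℕ) : ℝ) * √d ^ p) ^ 2 *
          ((N ^ d : ℕ) * (1 - ((N ^ d : ℕ) : ℝ)⁻¹) ^ m) := by
  rcases Nat.eq_zero_or_pos d with rfl | hd
  · refine ⟨1, one_pos, fun m N i hN => ?_⟩
    have h (x : Fin (m + 1) → EuclideanSpace ℝ (Fin 0)) : Function.update x i 0 = x :=
      Subsingleton.elim _ _
    have h0 : 0 ≤ (1 - (((N ^ 0 : ℕ) : ℝ))⁻¹) ^ m := by simp
    simp only [h, sub_self, ne_eq, OfNat.ofNat_ne_zero, not_false_eq_true, zero_pow,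
      integral_zero]
    positivity
  obtain ⟨B, hB, hcost⟩ := exists_tspCost_le_of_dense hp d
  refine ⟨B, hB, fun m N i hN => ?_⟩
  obtain ⟨A, hA, hPA, hdense⟩ := exists_sparse_set (d := d) hN i
  obtain ⟨δ, hδ⟩ : ∃ δ : ℝ, δ = √d / N := ⟨_, rfl⟩
  have hδ0 : 0 < δ := by
    have : (0 : ℝ) < d := by exact_mod_cast hd
    rw [hδ]; positivity
  obtain ⟨M, hM⟩ : ∃ M : ℝ, M = ((m + 1 : ℕ) : ℝ) * √d ^ p := ⟨_, rfl⟩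
  have hpt : ∀ᵐ x ∂(Measure.pi fun _ : Fin (m + 1) => cubeUniform d),
      (truncatedCost p x - truncatedCost p (Function.update x i 0)) ^ 2 ≤
        (B * δ ^ p) ^ 2 + A.indicator (fun _ => M ^ 2) x := by
    filter_upwards [ae_mem_unitCube d (m + 1)] with x hx
    by_cases hxA : x ∈ A
    · rw [Set.indicator_of_mem hxA]
      obtain ⟨h0, h1⟩ := truncatedCost_mem_Icc p x
      obtain ⟨h2, h3⟩ := truncatedCost_mem_Icc p (Function.update x i 0)
      have : (truncatedCost p x - truncatedCost p (Function.update x i 0)) ^ 2 ≤ M ^ 2 := by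
        rw [hM]
        exact sq_le_sq' (by linarith) (by linarith)
      linarith [sq_nonneg (B * δ ^ p)]
    · rw [Set.indicator_of_notMem hxA, add_zero, ← sq_abs]
      have hne (k) (hk : k ≠ i) : Function.update x i 0 k = x k := Function.update_of_ne hk _ _
      have hx' (k) : Function.update x i 0 k ∈ unitCube d := by
        rcases eq_or_ne k i with rfl | hk
        · rw [Function.update_self]
          exact zero_mem_unitCube d
        · rw [hne k hk]
          exact hx k
      have hd1 := hdense x hxA
      rw [← hδ] at hd1
      have hd2 (y) (hy : y ∈ unitCube d) : ∃ j ≠ i, ‖Function.update x i 0 j - y‖ ≤ δ := by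
        obtain ⟨j, hj, h⟩ := hd1 y hy
        exact ⟨j, hj, by rwa [hne j hj]⟩
      have h1 := hcost (convex_unitCube d) hx (hx' i) hne hδ0 hd1
      have h2 := hcost (convex_unitCube d) hx' (hx i) (fun k hk => (hne k hk).symm) hδ0 hd2
      refine pow_le_pow_left₀ (abs_nonneg _) ((abs_inf_sub_inf_le_abs _ _ _).trans ?_) 2
      rw [abs_sub_le_iff]
      constructor <;> linarith
  have hmeas := (measurable_truncatedCost (d := d) (n := m + 1) hp)
  have hupd : Measurable fun x : Fin (m + 1) → EuclideanSpace ℝ (Fin d) =>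
      truncatedCost p (Function.update x i 0) :=
    hmeas.comp (measurable_update_left)
  have hint : Integrable (A.indicator fun _ => M ^ 2)
      (Measure.pi fun _ : Fin (m + 1) => cubeUniform d) :=
    (integrable_const _).indicator hA
  calc _ ≤ ∫ x, ((B * δ ^ p) ^ 2 + A.indicator (fun _ => M ^ 2) x)
        ∂(Measure.pi fun _ : Fin (m + 1) => cubeUniform d) := by
        refine integral_mono_ae ?_ ((integrable_const _).add hint) hpt
        refine integrable_of_abs_le (M := (2 * M) ^ 2) ((hmeas.sub hupd).pow_const 2) fun x => ?_
        rw [abs_pow]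
        refine pow_le_pow_left₀ (abs_nonneg _) ((abs_sub _ _).trans ?_) 2
        linarith [abs_truncatedCost_le p x, abs_truncatedCost_le p (Function.update x i 0)]
    _ = (B * δ ^ p) ^ 2 + M ^ 2 * (Measure.pi fun _ : Fin (m + 1) => cubeUniform d).real A := by
        rw [integral_add (integrable_const _) hint, integral_indicator_const _ hA]
        simp [mul_comm]
    _ ≤ _ := by
        rw [← hδ, ← hM]
        gcongr

theorem exists_variance_tspCost_le {d : ℕ} (hd : 1 ≤ d) {p : ℝ} (hp : 1 ≤ p) :
    ∃ K > 0, ∀ n : ℕ, 1 ≤ n →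
      ProbabilityTheory.variance (fun x => tspCost p x)
        (Measure.pi fun _ : Fin n => cubeUniform d) ≤ K * (n : ℝ) ^ (3 / 2 - 2 * p / d) := by
  obtain ⟨B, hB, hinfl⟩ := exists_integral_sq_sub_update_le hp d
  obtain ⟨C, hC, hgrid⟩ := exists_grid_size hd hp
  have hd0 : (0 : ℝ) < d := by exact_mod_cast hd
  refine ⟨(B ^ 2 + 1) * (√d ^ p) ^ 2 * C, by positivity, fun n hn => ?_⟩
  obtain ⟨m, rfl⟩ : ∃ m, n = m + 1 := ⟨n - 1, by omega⟩
  obtain ⟨N, hN, h1, h2⟩ := hgrid m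
  obtain ⟨t, ht⟩ : ∃ t : ℝ, t = ((m + 1 : ℕ) : ℝ) := ⟨_, rfl⟩
  have ht0 : 0 < t := by rw [ht]; positivity
  have hmeas := (measurable_truncatedCost (d := d) (n := m + 1) hp)
  rw [ProbabilityTheory.variance_congr (ae_truncatedCost_eq d (m + 1) hp),
    ProbabilityTheory.variance_eq_sub (MemLp.of_bound hmeas.aestronglyMeasurable _
      (ae_of_all _ (abs_truncatedCost_le p)))]
  have hES := efron_stein (cubeUniform d) (f := fun x => truncatedCost p x)
    (g := fun i x => truncatedCost p (Function.update x i 0)) hmeas (abs_truncatedCost_le p)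
    (fun i => hmeas.comp measurable_update_left) (fun i x => abs_truncatedCost_le p _)
    (fun i x a => by rw [Function.update_idem])
  refine hES.trans ((Finset.sum_le_sum fun i _ => hinfl m N i hN).trans ?_)
  rw [Finset.sum_const, Finset.card_univ, Fintype.card_fin, nsmul_eq_mul]
  rw [← ht] at h1 h2 ⊢
  calc t * ((B * (√d / N) ^ p) ^ 2 + (t * √d ^ p) ^ 2 *
        ((N ^ d : ℕ) * (1 - ((N ^ d : ℕ) : ℝ)⁻¹) ^ m))
      = t * (B ^ 2 * (√d ^ p) ^ 2 * (((N : ℝ)⁻¹) ^ p) ^ 2 + (√d ^ p) ^ 2 *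
        (t ^ 2 * ((N ^ d : ℕ) * (1 - ((N ^ d : ℕ) : ℝ)⁻¹) ^ m))) := by
        rw [div_eq_mul_inv, Real.mul_rpow (by positivity) (by positivity)]
        ring
    _ ≤ t * (B ^ 2 * (√d ^ p) ^ 2 * (C * t ^ (1 / 2 - 2 * p / d)) + (√d ^ p) ^ 2 *
        (C * t ^ (1 / 2 - 2 * p / d))) := by gcongr
    _ = (B ^ 2 + 1) * (√d ^ p) ^ 2 * C * t ^ (3 / 2 - 2 * p / d) := by
        rw [show (3 / 2 - 2 * p / d : ℝ) = 1 + (1 / 2 - 2 * p / d) by ring,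
          Real.rpow_add ht0 1, Real.rpow_one]
        ring

/-- **Concentration for the Euclidean TSP.**  Let `d ≥ 2` and `1 ≤ p < d²/2`.  There exist
`θ = θ(p,d) > 0` and `C = C(p,d) < ∞` such that for all `n ≥ 1` and `λ > 0`, if
`X_1,…,X_n` are i.i.d. uniform on `[0,1]^d`, then
`ℙ(|C^p_TS(X) − 𝔼[C^p_TS(X)]| ≥ λ n^{1−p/d}) ≤ C n^{−θ} λ^{−2}`. -/
theorem concentration_tsp
    (d : ℕ) (hd : 2 ≤ d) (p : ℝ) (hp1 : 1 ≤ p) (hp2 : p < (d : ℝ) ^ 2 / 2) :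
    ∃ θ C : ℝ, 0 < θ ∧ 0 < C ∧
      ∀ n : ℕ, 1 ≤ n → ∀ lam : ℝ, 0 < lam →
        Measure.pi (fun _ : Fin n => cubeUniform d)
            {X : Fin n → EuclideanSpace ℝ (Fin d) |
              lam * (n : ℝ) ^ (1 - p / d) ≤
                |tspCost p X -
                  ∫ Z, tspCost p Z ∂(Measure.pi (fun _ : Fin n => cubeUniform d))|} ≤
          ENNReal.ofReal (C * (n : ℝ) ^ (-θ) * lam ^ (-2 : ℝ)) := by
  obtain ⟨K, hK, hvar⟩ := exists_variance_tspCost_le (by omega : 1 ≤ d) hp1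
  refine ⟨1 / 2, K, by norm_num, hK, fun n hn lam hlam => ?_⟩
  have hn0 : (0 : ℝ) < n := by exact_mod_cast hn
  have hmem : MemLp (fun x => tspCost p x) 2 (Measure.pi fun _ : Fin n => cubeUniform d) :=
    (MemLp.of_bound (measurable_truncatedCost hp1).aestronglyMeasurable _
      (ae_of_all _ (abs_truncatedCost_le p))).ae_eq (ae_truncatedCost_eq d n hp1).symm
  have hc : 0 < lam * (n : ℝ) ^ (1 - p / d) := by positivity
  refine (ProbabilityTheory.meas_ge_le_variance_div_sq hmem hc).trans (ENNReal.ofReal_le_ofReal ?_)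
  rw [div_le_iff₀ (by positivity)]
  refine (hvar n hn).trans_eq ?_
  have h1 : lam ^ (-2 : ℝ) * lam ^ 2 = 1 := by
    rw [← Real.rpow_natCast lam 2, ← Real.rpow_add hlam]
    norm_num
  have h2 : (n : ℝ) ^ (3 / 2 - 2 * p / d) =
      (n : ℝ) ^ (-(1 / 2 : ℝ)) * ((n : ℝ) ^ (1 - p / d)) ^ 2 := by
    rw [← Real.rpow_natCast _ 2, ← Real.rpow_mul hn0.le, ← Real.rpow_add hn0]
    congr 1
    push_cast
    ring
  rw [h2]
  linear_combination
    -K * (n : ℝ) ^ (-(1 / 2 : ℝ)) * ((n : ℝ) ^ (1 - p / d)) ^ 2 * h1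
end

section
/- For every p > 1 there exist ε = ε(p) > 0 and C = C(p) < ∞ such that the following holds for every d ≥ 1. Let x_1,…,x_n be points in [0,1]^d and let τ be a permutation achieving the minimum in the TSP p-cost. Let a ∈ {1,…,n}, set z_e = (x_{τ(a)} + x_{τ(a+1)})/2 and B_e = B(z_e, ε·|x_{τ(a+1)} − x_{τ(a)}|). Then (#{ b ∈ {1,…,n} : x_{τ(b)} ∈ B_e }) · |x_{τ(a+1)} − x_{τ(a)}|^p ≤ C · ∑_{b : x_{τ(b)} ∈ B_e} |x_{τ(b+1)} − x_{τ(b)}|^p, where indices of τ are taken cyclically (τ(n+1) := τ(1)). -/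
open MeasureTheory Metric
open scoped Classical

/-- Reversal of the initial segment `{0, …, b}` of `ℕ`. -/
def segRev (b k : ℕ) : ℕ := if k ≤ b then b - k else k

theorem segRev_segRev (b k : ℕ) : segRev b (segRev b k) = k := by
  unfold segRev
  split_ifs <;> omega

/-- Reversing the segment `{0, …, b}` of the path `0, 1, …, m` changes only the edge leaving the
segment. -/
theorem sum_segRev_add {b m : ℕ} (hb : b < m) (f : ℕ → ℕ → ℝ) (hf : ∀ i j, f i j = f j i) :
    ∑ k ∈ Finset.range m, f (segRev b k) (segRev b (k + 1)) + f b (b + 1) =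
      ∑ k ∈ Finset.range m, f k (k + 1) + f 0 (b + 1) := by
  obtain ⟨c, rfl⟩ := Nat.exists_eq_add_of_le (Nat.succ_le_of_lt hb)
  rw [Finset.sum_range_add, Finset.sum_range_add, Finset.sum_range_succ, Finset.sum_range_succ]
  have hinit : ∑ k ∈ Finset.range b, f (segRev b k) (segRev b (k + 1)) =
      ∑ k ∈ Finset.range b, f k (k + 1) := by
    rw [← Finset.sum_range_reflect]
    refine Finset.sum_congr rfl fun k hk => ?_
    have hk := Finset.mem_range.mp hk
    rw [hf]
    unfold segRev
    congr 1 <;> split_ifs <;> omega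
  have htail : ∑ k ∈ Finset.range c, f (segRev b (b.succ + k)) (segRev b (b.succ + k + 1)) =
      ∑ k ∈ Finset.range c, f (b.succ + k) (b.succ + k + 1) := by
    refine Finset.sum_congr rfl fun k _ => ?_
    unfold segRev
    congr 1 <;> split_ifs <;> omega
  have hb0 : segRev b b = 0 := by simp [segRev]
  have hb1 : segRev b (b + 1) = b + 1 := by simp [segRev]
  rw [hinit, htail, hb0, hb1]
  ring

/-- Reversal of the initial segment `{0, …, b}` as a permutation of `Fin (m + 1)`. -/
def segRevPerm {m : ℕ} (b : Fin (m + 1)) : Equiv.Perm (Fin (m + 1)) :=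
  Function.Involutive.toPerm
    (fun k => ⟨segRev b k, by unfold segRev; split_ifs <;> omega⟩)
    (fun k => Fin.ext (segRev_segRev b k))

theorem val_segRevPerm {m : ℕ} (b k : Fin (m + 1)) :
    (segRevPerm b k : ℕ) = segRev b k := rfl

theorem sum_fin_cycle {m : ℕ} (g : Fin (m + 1) → Fin (m + 1) → ℝ) (σ : Fin (m + 1) → Fin (m + 1))
    (r : ℕ → ℕ) (hr : ∀ k : Fin (m + 1), (σ k : ℕ) = r k) :
    ∑ k, g (σ k) (σ (k + 1)) =
      ∑ k ∈ Finset.range m, g (Fin.ofNat (m + 1) (r k)) (Fin.ofNat (m + 1) (r (k + 1))) +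
        g (σ (Fin.last m)) (σ 0) := by
  have hσ : ∀ k : Fin (m + 1), σ k = Fin.ofNat (m + 1) (r k) := fun k => by
    rw [← hr]
    exact (Fin.ofNat_val_eq_self (σ k)).symm
  rw [Fin.sum_univ_castSucc, Fin.last_add_one, Finset.sum_range]
  congr 1
  refine Finset.sum_congr rfl fun k _ => ?_
  rw [hσ, hσ, Fin.coeSucc_eq_succ, Fin.val_succ, Fin.val_castSucc]

/-- The 2-opt move: reversing `{0, …, b}` in the cycle `0, 1, …, m` exchanges the edges
`(m, 0)` and `(b, b + 1)` for `(m, b)` and `(0, b + 1)`. -/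
theorem sum_segRevPerm_add {m : ℕ} (g : Fin (m + 1) → Fin (m + 1) → ℝ)
    (hg : ∀ i j, g i j = g j i) (b : Fin (m + 1)) (hb : b ≠ Fin.last m) :
    ∑ k, g (segRevPerm b k) (segRevPerm b (k + 1)) + (g (Fin.last m) 0 + g b (b + 1)) =
      ∑ k, g k (k + 1) + (g (Fin.last m) b + g 0 (b + 1)) := by
  have hbm : (b : ℕ) < m := Fin.val_lt_last hb
  have key := sum_segRev_add hbm
    (fun i j => g (Fin.ofNat (m + 1) i) (Fin.ofNat (m + 1) j)) (fun i j => hg _ _)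
  have h1 := sum_fin_cycle g (segRevPerm b) (segRev b) (val_segRevPerm b)
  have h2 := sum_fin_cycle g id id (fun _ => rfl)
  have hlast : segRevPerm b (Fin.last m) = Fin.last m := by
    ext
    rw [val_segRevPerm]
    simp [segRev, hbm]
  have hzero : segRevPerm b 0 = b := by
    ext
    rw [val_segRevPerm]
    simp [segRev]
  have hb' : Fin.ofNat (m + 1) (b : ℕ) = b := Fin.ofNat_val_eq_self b
  have hb1 : Fin.ofNat (m + 1) ((b : ℕ) + 1) = b + 1 := by
    ext
    simp [Fin.val_add]
  have h0 : Fin.ofNat (m + 1) 0 = 0 := rfl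
  rw [hlast, hzero] at h1
  simp only [id] at h2
  simp only [hb', hb1, h0] at key
  rw [h1, h2]
  linarith

/-- An optimal tour cannot be improved by a 2-opt move. -/
theorem two_opt_le {d n : ℕ} {p : ℝ} {x : Fin n → EuclideanSpace ℝ (Fin d)}
    {τ : Equiv.Perm (Fin n)} (hτ : ∀ τ' : Equiv.Perm (Fin n), tspLen p x τ ≤ tspLen p x τ')
    {a b : Fin n} (hab : b ≠ a) :
    ‖x (τ a) - x (τ (finRotate n a))‖ ^ p + ‖x (τ b) - x (τ (finRotate n b))‖ ^ p ≤
      ‖x (τ a) - x (τ b)‖ ^ p + ‖x (τ (finRotate n a)) - x (τ (finRotate n b))‖ ^ p := by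
  cases n with
  | zero => exact a.elim0
  | succ m =>
    simp only [finRotate_apply]
    set s : Equiv.Perm (Fin (m + 1)) := Equiv.addRight (a + 1) with hs
    have hsk : ∀ k, s k = k + (a + 1) := fun k => rfl
    set g : Fin (m + 1) → Fin (m + 1) → ℝ :=
      fun i j => ‖x (τ (s i)) - x (τ (s j))‖ ^ p with hg
    have hb : b - (a + 1) ≠ Fin.last m := by
      intro h
      apply hab
      calc b = b - (a + 1) + 1 + a := by abel
        _ = a := by rw [h, Fin.last_add_one, zero_add]
    have key := sum_segRevPerm_add g (fun i j => by simp only [hg, norm_sub_rev]) _ hb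
    have hsum : ∑ k, g k (k + 1) = tspLen p x τ := by
      unfold tspLen
      refine Eq.trans ?_ (Equiv.sum_comp s _)
      refine Finset.sum_congr rfl fun k _ => ?_
      simp only [hg, hsk, finRotate_apply]
      rw [add_right_comm]
    have hopt := hτ ((segRevPerm (b - (a + 1))).trans (s.trans τ))
    have hrev : tspLen p x ((segRevPerm (b - (a + 1))).trans (s.trans τ)) =
        ∑ k, g (segRevPerm (b - (a + 1)) k) (segRevPerm (b - (a + 1)) (k + 1)) := by
      unfold tspLen
      simp only [hg, Equiv.trans_apply, finRotate_apply]
    have e1 : s (Fin.last m) = a := by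
      rw [hsk, add_comm a 1, ← add_assoc, Fin.last_add_one, zero_add]
    have e2 : s 0 = a + 1 := by rw [hsk, zero_add]
    have e3 : s (b - (a + 1)) = b := by rw [hsk, sub_add_cancel]
    have e4 : s (b - (a + 1) + 1) = b + 1 := by rw [hsk]; abel
    rw [hsum, ← hrev] at key
    simp only [hg, e1, e2, e3, e4] at key
    linarith

/-- **Local edge-to-energy control for the TSP.**  For every `p > 1` there exist
`ε = ε(p) > 0` and `C = C(p) < ∞` such that for every `d ≥ 1`, points
`x_1,…,x_n ∈ [0,1]^d`, any optimal tour `τ` and any `a`, with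
`z_e = (x_{τ(a)} + x_{τ(a+1)})/2` and `B_e = B(z_e, ε|x_{τ(a+1)} − x_{τ(a)}|)`
(indices cyclic, `a+1 = finRotate n a`), one has
`#{b : x_{τ(b)} ∈ B_e} · |x_{τ(a+1)} − x_{τ(a)}|^p ≤
 C ∑_{b : x_{τ(b)} ∈ B_e} |x_{τ(b+1)} − x_{τ(b)}|^p`. -/
theorem local_edge_to_energy_tsp (p : ℝ) (hp : 1 < p) :
    ∃ ε C : ℝ, 0 < ε ∧ 0 < C ∧
      ∀ d : ℕ, 1 ≤ d →
        ∀ (n : ℕ) (x : Fin n → EuclideanSpace ℝ (Fin d)),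
          (∀ i, x i ∈ unitCube d) →
          ∀ τ : Equiv.Perm (Fin n),
            (∀ τ' : Equiv.Perm (Fin n), tspLen p x τ ≤ tspLen p x τ') →
            ∀ a : Fin n,
              ((Finset.univ.filter fun b =>
                  x (τ b) ∈ ball (midpoint ℝ (x (τ a)) (x (τ (finRotate n a))))
                    (ε * ‖x (τ (finRotate n a)) - x (τ a)‖)).card : ℝ) *
                  ‖x (τ (finRotate n a)) - x (τ a)‖ ^ p ≤
                C * ∑ b ∈ Finset.univ.filter (fun b =>
                      x (τ b) ∈ ball (midpoint ℝ (x (τ a)) (x (τ (finRotate n a))))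
                        (ε * ‖x (τ (finRotate n a)) - x (τ a)‖)),
                  ‖x (τ (finRotate n b)) - x (τ b)‖ ^ p := by
  set q : ℝ := (1 / 2 : ℝ) ^ (1 / p) with hq
  have hp0 : 0 < p := by linarith
  have hqp : q ^ p = 1 / 2 := by
    rw [hq, ← Real.rpow_mul (by norm_num), one_div_mul_cancel hp0.ne', Real.rpow_one]
  have hq1 : q < 1 := Real.rpow_lt_one (by norm_num) (by norm_num) (by positivity)
  have hq2 : 1 / 2 < q := by
    have h := Real.rpow_lt_rpow_of_exponent_gt (x := 1 / 2) (by norm_num) (by norm_num)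
      ((div_lt_one hp0).mpr hp)
    rwa [Real.rpow_one] at h
  set δ : ℝ := (q - 1 / 2) / 2 with hδ
  have hδ0 : 0 < δ := by linarith
  refine ⟨δ, (δ ^ p)⁻¹, hδ0, by positivity, ?_⟩
  intro d _ n x _ τ hτ a
  set u := x (τ a) with hu
  set v := x (τ (finRotate n a)) with hv
  set l := ‖v - u‖ with hl
  have hl0 : 0 ≤ l := norm_nonneg _
  rw [← nsmul_eq_mul, Finset.mul_sum]
  refine Finset.card_nsmul_le_sum _ _ _ fun b hb => ?_
  have hb := (Finset.mem_filter.mp hb).2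
  rw [mem_ball] at hb
  have hlpos : 0 < l := pos_of_mul_pos_right (dist_nonneg.trans_lt hb) hδ0.le
  have hum : dist u (midpoint ℝ u v) = 1 / 2 * l := by
    rw [dist_left_midpoint, dist_comm, dist_eq_norm, ← hl]
    norm_num
  have hvm : dist v (midpoint ℝ u v) = 1 / 2 * l := by
    rw [dist_right_midpoint, dist_comm, dist_eq_norm, ← hl]
    norm_num
  have hba : b ≠ a := by
    rintro rfl
    rw [← hu, hum] at hb
    nlinarith
  have hfar : δ * l ≤ ‖x (τ (finRotate n b)) - x (τ b)‖ := by
    by_contra! hlt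
    have h1 : ‖u - x (τ b)‖ ≤ q * l := by
      rw [← dist_eq_norm]
      have := dist_triangle_right u (x (τ b)) (midpoint ℝ u v)
      nlinarith
    have h2 : ‖v - x (τ (finRotate n b))‖ < q * l := by
      rw [← dist_eq_norm] at hlt ⊢
      have := dist_triangle_right v (x (τ b)) (midpoint ℝ u v)
      have := dist_triangle_right v (x (τ (finRotate n b))) (x (τ b))
      nlinarith
    have h3 := two_opt_le hτ hba
    rw [← hu, ← hv, norm_sub_rev u v, ← hl] at h3
    have h4 := Real.rpow_le_rpow (norm_nonneg _) h1 hp0.le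
    have h5 := Real.rpow_lt_rpow (norm_nonneg _) h2 hp0
    rw [Real.mul_rpow (by linarith) hl0, hqp] at h4 h5
    have h6 : 0 ≤ ‖x (τ b) - x (τ (finRotate n b))‖ ^ p := by positivity
    linarith
  rw [inv_mul_eq_div, le_div_iff₀ (by positivity), mul_comm, ← Real.mul_rpow hδ0.le hl0]
  exact Real.rpow_le_rpow (by positivity) hfar hp0.le
end

section
/- For every p > 1 there exist ε = ε(p) > 0 and C = C(p) < ∞ such that the following holds for every d ≥ 1. Let u, u', v, v' be points in ℝ^d satisfying the 2-opt inequality |u − u'|^p + |v − v'|^p ≤ |u − v|^p + |u' − v'|^p, and suppose that |v − (u + u')/2| ≤ ε·|u − u'|. Then |u − u'|^p ≤ C·|v − v'|^p. -/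
/-- **Pointwise consequence of the 2-opt inequality.**  For every `p > 1` there exist
`ε = ε(p) > 0` and `C = C(p) < ∞` such that for every `d ≥ 1`: if points
`u, u', v, v' ∈ ℝ^d` satisfy the 2-opt inequality
`|u − u'|^p + |v − v'|^p ≤ |u − v|^p + |u' − v'|^p` and
`|v − (u + u')/2| ≤ ε |u − u'|`, then `|u − u'|^p ≤ C |v − v'|^p`. -/
theorem two_opt_pointwise (p : ℝ) (hp : 1 < p) :
    ∃ ε C : ℝ, 0 < ε ∧ 0 < C ∧
      ∀ d : ℕ, 1 ≤ d →
        ∀ u u' v v' : EuclideanSpace ℝ (Fin d),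
          ‖u - u'‖ ^ p + ‖v - v'‖ ^ p ≤ ‖u - v‖ ^ p + ‖u' - v'‖ ^ p →
          ‖v - midpoint ℝ u u'‖ ≤ ε * ‖u - u'‖ →
          ‖u - u'‖ ^ p ≤ C * ‖v - v'‖ ^ p := by
  obtain ⟨a, ha, hap⟩ : ∃ a : ℝ, 1 / 2 < a ∧ a ^ p = 1 / 2 := by
    have hp0 : 0 < p := by linarith
    refine ⟨(1 / 2 : ℝ) ^ p⁻¹, ?_, Real.rpow_inv_rpow (by norm_num) hp0.ne'⟩
    simpa using Real.rpow_lt_rpow_of_exponent_gt (x := (1 / 2 : ℝ)) (by norm_num) (by norm_num)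
      (inv_lt_one_of_one_lt₀ hp)
  obtain ⟨η, hη, rfl⟩ : ∃ η : ℝ, 0 < η ∧ a = 1 / 2 + 2 * η :=
    ⟨(a - 1 / 2) / 2, by linarith, by ring⟩
  refine ⟨η, (η ^ p)⁻¹, hη, by positivity, ?_⟩
  intro d _ u u' v v' hopt hmid
  have hηL : η * ‖u - u'‖ ≤ ‖v - v'‖ := by
    by_contra! hlt
    have hL : 0 < ‖u - u'‖ :=
      pos_of_mul_pos_right ((norm_nonneg _).trans_lt hlt) hη.le
    have hum : ‖u - midpoint ℝ u u'‖ = 1 / 2 * ‖u - u'‖ := by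
      simpa [dist_eq_norm] using dist_left_midpoint (𝕜 := ℝ) u u'
    have hum' : ‖u' - midpoint ℝ u u'‖ = 1 / 2 * ‖u - u'‖ := by
      simpa [dist_eq_norm] using dist_right_midpoint (𝕜 := ℝ) u u'
    have huv : ‖u - v‖ < (1 / 2 + 2 * η) * ‖u - u'‖ := by
      have h := norm_sub_le_norm_sub_add_norm_sub u (midpoint ℝ u u') v
      rw [norm_sub_rev (midpoint ℝ u u') v] at h
      nlinarith [mul_pos hη hL]
    have huv' : ‖u' - v'‖ < (1 / 2 + 2 * η) * ‖u - u'‖ := by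
      have h := norm_sub_le_norm_sub_add_norm_sub u' (midpoint ℝ u u') v
      rw [norm_sub_rev (midpoint ℝ u u') v] at h
      have h' := norm_sub_le_norm_sub_add_norm_sub u' v v'
      linarith
    have hp0 : 0 < p := by linarith
    have h₁ := Real.rpow_lt_rpow (norm_nonneg _) huv hp0
    have h₂ := Real.rpow_lt_rpow (norm_nonneg _) huv' hp0
    rw [Real.mul_rpow (by linarith) hL.le, hap] at h₁ h₂
    have h₃ : 0 ≤ ‖v - v'‖ ^ p := by positivity
    linarith
  rw [inv_mul_eq_div, le_div_iff₀' (by positivity), ← Real.mul_rpow hη.le (norm_nonneg _)]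
  exact Real.rpow_le_rpow (by positivity) hηL (by linarith)
end
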